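/- Let 𝔠 > 0, T > 0, z := 𝔠²/T, u ∈ ℝ³, u₀ := √(𝔠²+|u|²), and for p ∈ ℝ³ set p₀ := √(𝔠²+|p|²) and J(p) := (z/(4π𝔠³K₂(z))) · exp(−z(p₀u₀ − p·u)/𝔠²). Then for each i ∈ {1,2,3}: ∫_{ℝ³} pᵢ · J(p) dp = (u₀uᵢ/𝔠) · (K₃(z)/K₂(z)). -/

import Mathlib

open MeasureTheory

/-- The Euclidean norm on ℝ³. -/
noncomputable def norm3 (p : Fin 3 → ℝ) : ℝ := Real.sqrt (p 0 ^ 2 + p 1 ^ 2 + p 2 ^ 2)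

/-- The Euclidean inner product on ℝ³. -/
def dot3 (p q : Fin 3 → ℝ) : ℝ := p 0 * q 0 + p 1 * q 1 + p 2 * q 2

/-- The modified Bessel function K_α(z) = ∫₀^∞ e^{−z cosh t} cosh(αt) dt. -/
noncomputable def Kb (α z : ℝ) : ℝ :=
  ∫ t in Set.Ioi (0 : ℝ), Real.exp (-z * Real.cosh t) * Real.cosh (α * t)

/-- The relativistic Maxwellian (Jüttner distribution) with density 1, bulk velocity u and
temperature T, where z = c²/T:
J(p) = (z/(4πc³K₂(z))) exp(−z(p₀u₀ − p·u)/c²). -/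
noncomputable def Jutt (c T : ℝ) (u p : Fin 3 → ℝ) : ℝ :=
  (c ^ 2 / T) / (4 * Real.pi * c ^ 3 * Kb 2 (c ^ 2 / T)) *
    Real.exp (-(c ^ 2 / T) *
      (Real.sqrt (c ^ 2 + norm3 p ^ 2) * Real.sqrt (c ^ 2 + norm3 u ^ 2) - dot3 p u) /
        c ^ 2)

theorem pow_mul_exp_neg_le {δ x : ℝ} (hδ : 0 < δ) (hx : 0 ≤ x) (n : ℕ) :
    x ^ n * Real.exp (-(δ * x)) ≤ n.factorial / δ ^ n := by
  have h := Real.pow_div_factorial_le_exp (δ * x) (by positivity) n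
  rw [div_le_iff₀ (by positivity), mul_pow] at h
  rw [Real.exp_neg, ← div_eq_mul_inv, div_le_div_iff₀ (Real.exp_pos _) (by positivity)]
  linarith

theorem integrable_cosh_pow_mul_exp_neg_mul_cosh {z : ℝ} (hz : 0 < z) (n : ℕ) :
    Integrable fun t : ℝ ↦ Real.cosh t ^ n * Real.exp (-z * Real.cosh t) := by
  have hgauss := (integrable_exp_neg_mul_sq (b := z / 8) (by positivity)).const_mul
    (n.factorial / (z / 2) ^ n)
  refine hgauss.mono' (Continuous.aestronglyMeasurable (by fun_prop)) (.of_forall fun t ↦ ?_)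
  have hcosh : t ^ 2 / 4 ≤ Real.cosh t := by
    rw [← Real.cosh_abs, Real.cosh_eq]
    nlinarith [Real.quadratic_le_exp_of_nonneg (abs_nonneg t), sq_abs t, abs_nonneg t,
      Real.exp_pos (-|t|)]
  rw [Real.norm_of_nonneg (mul_nonneg (pow_nonneg (Real.cosh_pos t).le n) (Real.exp_pos _).le)]
  calc Real.cosh t ^ n * Real.exp (-z * Real.cosh t)
      = Real.cosh t ^ n * Real.exp (-(z / 2 * Real.cosh t)) *
          Real.exp (-(z / 2 * Real.cosh t)) := by
        rw [mul_assoc, ← Real.exp_add]; ring_nf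
    _ ≤ _ := by
        refine mul_le_mul (pow_mul_exp_neg_le (by positivity) (Real.cosh_pos t).le n)
          (Real.exp_le_exp.2 ?_) (Real.exp_pos _).le (by positivity)
        nlinarith

theorem abs_sinh_le_cosh (t : ℝ) : |Real.sinh t| ≤ Real.cosh t :=
  abs_le_of_sq_le_sq (by nlinarith [Real.cosh_sq t]) (Real.cosh_pos t).le

theorem integrable_sinh_pow_mul_cosh_pow {z : ℝ} (hz : 0 < z) (m n : ℕ) :
    Integrable fun t : ℝ ↦
      Real.sinh t ^ m * Real.cosh t ^ n * Real.exp (-z * Real.cosh t) := by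
  refine (integrable_cosh_pow_mul_exp_neg_mul_cosh hz (m + n)).mono'
    (Continuous.aestronglyMeasurable (by fun_prop)) (.of_forall fun t ↦ ?_)
  have hc := Real.cosh_pos t
  rw [norm_mul, norm_mul, norm_pow, norm_pow, Real.norm_of_nonneg hc.le,
    Real.norm_of_nonneg (Real.exp_pos _).le, Real.norm_eq_abs, pow_add]
  gcongr
  exact abs_sinh_le_cosh t

theorem integral_cosh_eq_two_mul_Kb (α z : ℝ) :
    ∫ t : ℝ, Real.exp (-z * Real.cosh t) * Real.cosh (α * t) = 2 * Kb α z := by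
  rw [Kb, ← integral_comp_abs]
  refine integral_congr_ae (.of_forall fun t ↦ ?_)
  simp only [Real.cosh_abs]
  rw [← Real.cosh_abs (α * t), ← Real.cosh_abs (α * |t|)]
  simp [abs_mul]

theorem integral_eq_zero_of_neg {f : ℝ → ℝ} (hf : ∀ t, f (-t) = -f t) : ∫ t, f t = 0 := by
  have h := integral_neg_eq_self f volume
  simp only [hf, integral_neg] at h
  linarith

theorem integral_sinh_cosh_shift {z : ℝ} (hz : 0 < z) (η : ℝ) :
    ∫ t : ℝ, Real.sinh (t + η) * Real.cosh (t + η) * (z * Real.cosh η * Real.cosh (t + η) + 1) *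
      Real.exp (-z * Real.cosh t) = 2 * z * Real.sinh η * Real.cosh η ^ 3 * Kb 3 z := by
  set C := Real.cosh η with hC
  set S := Real.sinh η with hS
  have hCS : C ^ 2 = S ^ 2 + 1 := Real.cosh_sq η
  have hint := integrable_sinh_pow_mul_cosh_pow hz
  let E : ℝ → ℝ := fun t ↦ Real.exp (-z * Real.cosh t)
  let main : ℝ → ℝ := fun t ↦ Real.exp (-z * Real.cosh t) * Real.cosh (3 * t)
  let F' : ℝ → ℝ := fun t ↦ S * C * (Real.cosh t * Real.cosh t + Real.sinh t * Real.sinh t -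
    z * (Real.sinh t ^ 2 * Real.cosh t)) * E t
  let odd : ℝ → ℝ := fun t ↦
    (z * C * (Real.sinh t * C * (Real.cosh t ^ 2 * (C ^ 2 + 2 * S ^ 2) + Real.sinh t ^ 2 * S ^ 2)) +
      Real.sinh t * Real.cosh t * (C ^ 2 + S ^ 2)) * E t
  have hmain : Integrable main := by
    refine (((hint 0 3).const_mul 4).sub ((hint 0 1).const_mul 3)).congr (.of_forall fun t ↦ ?_)
    simp only [main, Real.cosh_three_mul, Pi.sub_apply]; ring
  have hF' : Integrable F' := by
    refine ((((hint 0 2).add (hint 2 0)).sub ((hint 2 1).const_mul z)).const_mul (S * C)).congr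
      (.of_forall fun t ↦ ?_)
    simp only [F', E, Pi.sub_apply, Pi.add_apply]; ring
  have hodd : Integrable odd := by
    refine ((((hint 1 2).const_mul (z * C * C * (C ^ 2 + 2 * S ^ 2))).add
      ((hint 3 0).const_mul (z * C * C * S ^ 2))).add
      ((hint 1 1).const_mul (C ^ 2 + S ^ 2))).congr (.of_forall fun t ↦ ?_)
    simp only [odd, E, Pi.add_apply]; ring
  have hF'0 : ∫ t, F' t = 0 := by
    refine integral_eq_zero_of_hasDerivAt_of_integrable
      (f := fun t ↦ S * C * (Real.sinh t * Real.cosh t) * E t) (fun t ↦ ?_) hF' ?_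
    · have h := ((((Real.hasDerivAt_sinh t).mul (Real.hasDerivAt_cosh t)).const_mul (S * C)).mul
        (((Real.hasDerivAt_cosh t).const_mul (-z)).exp))
      refine h.congr_deriv ?_
      simp only [F', E, Pi.mul_apply]; ring
    · refine ((hint 1 1).const_mul (S * C)).congr (.of_forall fun t ↦ ?_)
      simp only [E]; ring
  have hodd0 : ∫ t, odd t = 0 := integral_eq_zero_of_neg fun t ↦ by
    simp only [odd, E, Real.sinh_neg, Real.cosh_neg]; ring
  have hsplit : ∀ t, Real.sinh (t + η) * Real.cosh (t + η) *
      (z * C * Real.cosh (t + η) + 1) * Real.exp (-z * Real.cosh t) =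
      z * S * C ^ 3 * main t + F' t + odd t := fun t ↦ by
    have ht := Real.cosh_sq t
    simp only [main, F', odd, E, Real.cosh_three_mul, Real.sinh_add, Real.cosh_add, ← hC, ← hS]
    generalize Real.exp (-z * Real.cosh t) = e
    generalize Real.cosh t = x at *
    generalize Real.sinh t = y at *
    linear_combination (e * z * S * C * x) * (-3 * C ^ 2 * ht - y ^ 2 * hCS)
  simp_rw [hsplit]
  rw [integral_add (f := fun t ↦ z * S * C ^ 3 * main t + F' t)
    ((hmain.const_mul _).add hF') hodd, integral_add (hmain.const_mul _) hF',
    integral_const_mul, hF'0, hodd0, integral_cosh_eq_two_mul_Kb]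
  ring

theorem integral_exp_neg_mul_sqrt {b M : ℝ} (hb : 0 < b) (hM : 0 < M) :
    ∫ y : ℝ × ℝ, Real.exp (-(b * √(M + (y.1 ^ 2 + y.2 ^ 2)))) =
      2 * Real.pi * ((√M / b + 1 / b ^ 2) * Real.exp (-(b * √M))) := by
  have hradial : ∫ r in Set.Ioi (0 : ℝ), r * Real.exp (-(b * √(M + r ^ 2))) =
      (√M / b + 1 / b ^ 2) * Real.exp (-(b * √M)) := by
    have hs : ∀ r : ℝ, 0 < M + r ^ 2 := fun r ↦ by positivity
    rw [integral_Ioi_of_hasDerivAt_of_nonneg' (l := 0)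
      (g := fun r ↦ -((√(M + r ^ 2) / b + 1 / b ^ 2) * Real.exp (-(b * √(M + r ^ 2)))))]
    · simp
    · intro r _
      have h0 := (((hasDerivAt_pow 2 r).const_add M).sqrt (hs r).ne')
      have h := (((h0.div_const b).add_const (1 / b ^ 2)).mul ((h0.const_mul b).neg.exp)).neg
      refine h.congr_deriv ?_
      have := (Real.sqrt_pos.2 (hs r)).ne'
      simp
      field_simp
      ring
    · intro r hr
      have : (0 : ℝ) < r := hr
      positivity
    · have hb' : Filter.Tendsto (fun r : ℝ ↦ √(M + r ^ 2)) Filter.atTop Filter.atTop :=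
        Real.tendsto_sqrt_atTop.comp (Filter.tendsto_atTop_add_const_left _ _
          (Filter.tendsto_pow_atTop two_ne_zero))
      have hx := Filter.Tendsto.comp (g := fun s : ℝ ↦ -((s / b + 1 / b ^ 2) * Real.exp (-(b * s))))
        (z := nhds 0) ?_ hb'
      · exact hx
      have h1 := (Real.tendsto_pow_mul_exp_neg_atTop_nhds_zero 1).comp
        (Filter.tendsto_id.const_mul_atTop hb)
      have h2 := (Real.tendsto_pow_mul_exp_neg_atTop_nhds_zero 0).comp
        (Filter.tendsto_id.const_mul_atTop hb)
      have h3 := ((h1.add h2).const_mul (1 / b ^ 2)).neg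
      simp only [add_zero, mul_zero, neg_zero] at h3
      refine h3.congr fun s ↦ ?_
      simp
      field_simp
  rw [← integral_comp_polarCoord_symm, polarCoord_target]
  have hcongr : ∀ p : ℝ × ℝ, p.1 • Real.exp (-(b * √(M + ((polarCoord.symm p).1 ^ 2 +
      (polarCoord.symm p).2 ^ 2)))) = (p.1 * Real.exp (-(b * √(M + p.1 ^ 2)))) * (fun _ ↦ 1) p.2 := by
    intro p
    have : (p.1 * Real.cos p.2) ^ 2 + (p.1 * Real.sin p.2) ^ 2 = p.1 ^ 2 := by
      linear_combination p.1 ^ 2 * Real.sin_sq_add_cos_sq p.2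
    simp [polarCoord_symm_apply, this]
  simp_rw [hcongr]
  rw [Measure.volume_eq_prod, setIntegral_prod_mul (fun r ↦ r * Real.exp (-(b * √(M + r ^ 2))))
    (fun _ ↦ (1 : ℝ)), hradial]
  simp [Real.pi_pos.le]
  ring

/-- The unnormalized Jüttner weight with bulk velocity `w` along the first coordinate axis and
inverse temperature `a`. -/
noncomputable def axisWeight (a c w : ℝ) (q : Fin 3 → ℝ) : ℝ :=
  Real.exp (-(a * (√(c ^ 2 + norm3 q ^ 2) * √(c ^ 2 + w ^ 2) - q 0 * w)))

theorem norm3_sq (p : Fin 3 → ℝ) : norm3 p ^ 2 = p 0 ^ 2 + p 1 ^ 2 + p 2 ^ 2 :=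
  Real.sq_sqrt (by positivity)

theorem abs_apply_le_norm3 (p : Fin 3 → ℝ) (j : Fin 3) : |p j| ≤ norm3 p := by
  refine Real.abs_le_sqrt ?_
  fin_cases j <;> simp <;> nlinarith [sq_nonneg (p 0), sq_nonneg (p 1), sq_nonneg (p 2)]

theorem integrable_apply_mul_axisWeight {a c : ℝ} (ha : 0 < a) (hc : 0 < c) (w : ℝ) (j : Fin 3) :
    Integrable fun q ↦ q j * axisWeight a c w q := by
  obtain ⟨δ, hδ, hδw⟩ : ∃ δ, 0 < δ ∧ δ = a * (√(c ^ 2 + w ^ 2) - |w|) := by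
    refine ⟨_, mul_pos ha (sub_pos.2 (Real.lt_sqrt_of_sq_lt ?_)), rfl⟩
    rw [sq_abs]
    nlinarith
  have hdecay : Integrable fun q : Fin 3 → ℝ ↦ (1 + ‖q‖) ^ (-(4 : ℝ)) :=
    integrable_one_add_norm (by norm_num [Module.finrank_fin_fun])
  refine (hdecay.const_mul (Real.exp δ * (Nat.factorial 5 / δ ^ 5))).mono'
    (Continuous.aestronglyMeasurable (by unfold axisWeight norm3; fun_prop))
    (.of_forall fun q ↦ ?_)
  have hq : ‖q‖ ≤ norm3 q :=
    (pi_norm_le_iff_of_nonneg (Real.sqrt_nonneg _)).2 (abs_apply_le_norm3 q)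
  have hP : norm3 q ≤ √(c ^ 2 + norm3 q ^ 2) := Real.le_sqrt_of_sq_le (by nlinarith)
  have hexp : axisWeight a c w q ≤ Real.exp δ * Real.exp (-(δ * (1 + ‖q‖))) := by
    rw [← Real.exp_add]
    refine Real.exp_le_exp.2 ?_
    have h1 : q 0 * w ≤ √(c ^ 2 + norm3 q ^ 2) * |w| := by
      refine (le_abs_self _).trans ?_
      rw [abs_mul]
      gcongr
      exact (abs_apply_le_norm3 q 0).trans hP
    have h2 : δ * ‖q‖ ≤ δ * √(c ^ 2 + norm3 q ^ 2) := by gcongr; exact hq.trans hP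
    rw [hδw] at h2 ⊢
    nlinarith [mul_le_mul_of_nonneg_left h1 ha.le]
  have hpow := pow_mul_exp_neg_le hδ (x := 1 + ‖q‖) (by positivity) 5
  have hn : 0 < 1 + ‖q‖ := by positivity
  rw [norm_mul, Real.norm_of_nonneg (show 0 ≤ axisWeight a c w q from (Real.exp_pos _).le),
    Real.rpow_neg hn.le, show (4 : ℝ) = (4 : ℕ) by norm_num, Real.rpow_natCast,
    ← div_eq_mul_inv, le_div_iff₀ (by positivity)]
  calc ‖q j‖ * axisWeight a c w q * (1 + ‖q‖) ^ 4
      ≤ (1 + ‖q‖) * (Real.exp δ * Real.exp (-(δ * (1 + ‖q‖)))) * (1 + ‖q‖) ^ 4 := by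
        gcongr
        · exact (Real.exp_pos _).le
        · linarith [norm_le_pi_norm q j]
    _ = Real.exp δ * ((1 + ‖q‖) ^ 5 * Real.exp (-(δ * (1 + ‖q‖)))) := by ring
    _ ≤ _ := by gcongr

theorem integral_apply_mul_axisWeight_of_ne_zero (a c w : ℝ) {j : Fin 3} (hj : j ≠ 0) :
    ∫ q, q j * axisWeight a c w q = 0 := by
  let e : (Fin 3 → ℝ) → (Fin 3 → ℝ) := fun q i ↦ if i = j then -q i else q i
  have he : MeasurePreserving e := by
    refine volume_preserving_pi (f := fun i (x : ℝ) ↦ if i = j then -x else x) fun i ↦ ?_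
    by_cases h : i = j
    · simpa [h] using Measure.measurePreserving_neg (volume : Measure ℝ)
    · simp only [h, if_false]
      exact MeasurePreserving.id _
  have hinv : Function.Involutive e := fun q ↦ by
    funext i; by_cases h : i = j <;> simp [e, h]
  have hemb : MeasurableEmbedding e :=
    (⟨hinv.toPerm, he.measurable, he.measurable⟩ : (Fin 3 → ℝ) ≃ᵐ (Fin 3 → ℝ)).measurableEmbedding
  have h := he.integral_comp hemb fun q ↦ q j * axisWeight a c w q
  have hneg : ∀ q, e q j * axisWeight a c w (e q) = -(q j * axisWeight a c w q) := fun q ↦ by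
    have hn : norm3 (e q) = norm3 q := by
      unfold norm3
      congr 1
      fin_cases j <;> simp [e]
    have h0 : e q 0 = q 0 := by simp [e, hj.symm]
    rw [axisWeight, hn, h0, axisWeight]
    simp [e]
  simp only [hneg, integral_neg] at h
  linarith

theorem integral_apply_zero_mul_axisWeight {c z : ℝ} (hc : 0 < c) (hz : 0 < z) (w : ℝ) :
    ∫ q, q 0 * axisWeight (z / c ^ 2) c w q =
      4 * Real.pi * c ^ 2 / z * √(c ^ 2 + w ^ 2) * w * Kb 3 z := by
  obtain ⟨η, rfl⟩ : ∃ η, w = c * Real.sinh η :=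
    ⟨Real.arsinh (w / c), by rw [Real.sinh_arsinh]; field_simp⟩
  have hsqrt : ∀ t, √(c ^ 2 + (c * Real.sinh t) ^ 2) = c * Real.cosh t := fun t ↦ by
    have h : c ^ 2 + (c * Real.sinh t) ^ 2 = (c * Real.cosh t) ^ 2 := by
      rw [mul_pow, mul_pow, Real.cosh_sq]; ring
    rw [h, Real.sqrt_sq (mul_pos hc (Real.cosh_pos t)).le]
  have hη := Real.cosh_pos η
  set b := z * Real.cosh η / c with hb
  have hb0 : 0 < b := by positivity
  let e : (Fin 3 → ℝ) ≃ᵐ ℝ × (ℝ × ℝ) := (MeasurableEquiv.piFinSuccAbove (fun _ ↦ ℝ) 0).trans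
    ((MeasurableEquiv.refl ℝ).prodCongr MeasurableEquiv.finTwoArrow)
  have he : MeasurePreserving e.symm volume volume :=
    (((volume_preserving_piFinSuccAbove (fun _ : Fin 3 ↦ ℝ) 0).trans
      ((MeasurePreserving.id volume).prod (volume_preserving_finTwoArrow ℝ)))).symm e
  have hval : ∀ p : ℝ × ℝ × ℝ, e.symm p 0 * axisWeight (z / c ^ 2) c (c * Real.sinh η) (e.symm p) =
      p.1 * Real.exp (z / c * p.1 * Real.sinh η) *
        Real.exp (-(b * √(c ^ 2 + p.1 ^ 2 + (p.2.1 ^ 2 + p.2.2 ^ 2)))) := fun p ↦ by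
    have h0 : e.symm p 0 = p.1 := rfl
    have h1 : e.symm p 1 = p.2.1 := rfl
    have h2 : e.symm p 2 = p.2.2 := rfl
    rw [axisWeight, norm3_sq, hsqrt, h0, h1, h2, mul_assoc, ← Real.exp_add, hb]
    congr 2
    rw [show c ^ 2 + (p.1 ^ 2 + p.2.1 ^ 2 + p.2.2 ^ 2) =
      c ^ 2 + p.1 ^ 2 + (p.2.1 ^ 2 + p.2.2 ^ 2) by ring]
    field_simp
    ring
  have hint : Integrable fun p : ℝ × ℝ × ℝ ↦
      e.symm p 0 * axisWeight (z / c ^ 2) c (c * Real.sinh η) (e.symm p) :=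
    he.integrable_comp_of_integrable (integrable_apply_mul_axisWeight (by positivity) hc _ 0)
  have hsinh : ∀ g : ℝ → ℝ, ∫ x, g x = ∫ t, c * Real.cosh t * g (c * Real.sinh t) := fun g ↦ by
    have h := integral_image_eq_integral_abs_deriv_smul (s := Set.univ)
      (f := fun t ↦ c * Real.sinh t) MeasurableSet.univ
      (fun t _ ↦ ((Real.hasDerivAt_sinh t).const_mul c).hasDerivWithinAt)
      (fun s _ t _ h ↦ Real.sinh_injective (mul_left_cancel₀ hc.ne' h)) g
    have himage : (fun t ↦ c * Real.sinh t) '' Set.univ = Set.univ := by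
      rw [Set.image_univ, Set.range_eq_univ]
      intro x
      obtain ⟨t, ht⟩ := Real.sinh_surjective (x / c)
      exact ⟨t, by simp only [ht]; field_simp⟩
    rw [himage] at h
    simpa [abs_of_pos, hc, Real.cosh_pos] using h
  rw [← he.integral_comp']
  rw [Measure.volume_eq_prod, integral_prod _ hint]
  simp_rw [hval, integral_const_mul]
  have hM : ∀ x : ℝ, 0 < c ^ 2 + x ^ 2 := fun x ↦ by positivity
  simp_rw [fun x ↦ integral_exp_neg_mul_sqrt hb0 (hM x)]
  rw [hsinh, ← integral_add_right_eq_self _ η]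
  have hfinal : ∀ t, c * Real.cosh (t + η) * (c * Real.sinh (t + η) *
      Real.exp (z / c * (c * Real.sinh (t + η)) * Real.sinh η) *
      (2 * Real.pi * ((√(c ^ 2 + (c * Real.sinh (t + η)) ^ 2) / b + 1 / b ^ 2) *
        Real.exp (-(b * √(c ^ 2 + (c * Real.sinh (t + η)) ^ 2)))))) =
      2 * Real.pi * c ^ 4 / (z ^ 2 * Real.cosh η ^ 2) *
      (Real.sinh (t + η) * Real.cosh (t + η) * (z * Real.cosh η * Real.cosh (t + η) + 1) *
        Real.exp (-z * Real.cosh t)) := fun t ↦ by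
    have hexp : Real.exp (-z * Real.cosh t) =
        Real.exp (z / c * (c * Real.sinh (t + η)) * Real.sinh η) *
          Real.exp (-(b * (c * Real.cosh (t + η)))) := by
      rw [← Real.exp_add, hb]
      congr 1
      have : Real.cosh t = Real.cosh (t + η) * Real.cosh η - Real.sinh (t + η) * Real.sinh η := by
        rw [← Real.cosh_sub]; ring_nf
      rw [this]
      field_simp
      ring
    rw [hsqrt, hexp, hb]
    field_simp
  simp_rw [hfinal]
  rw [integral_const_mul, integral_sinh_cosh_shift hz, hsqrt]
  field_simp
  ring

theorem exists_orthonormalBasis_smul_eq (v : EuclideanSpace ℝ (Fin 3)) :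
    ∃ b : OrthonormalBasis (Fin 3) ℝ (EuclideanSpace ℝ (Fin 3)), v = ‖v‖ • b 0 := by
  by_cases hv : v = 0
  · exact ⟨EuclideanSpace.basisFun _ ℝ, by simp [hv]⟩
  have hv' : ‖v‖ ≠ 0 := norm_ne_zero_iff.2 hv
  obtain ⟨b, hb⟩ := Orthonormal.exists_orthonormalBasis_extension_of_card_eq (𝕜 := ℝ)
    (E := EuclideanSpace ℝ (Fin 3)) (ι := Fin 3) (by simp) (v := fun _ ↦ ‖v‖⁻¹ • v) (s := {0})
    (by
      refine ⟨fun i ↦ ?_, fun i j hij ↦ (hij (Subsingleton.elim i j)).elim⟩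
      simp [norm_smul, hv'])
  exact ⟨b, by rw [hb 0 rfl, smul_inv_smul₀ hv']⟩

theorem integral_apply_mul_weight {c z : ℝ} (hc : 0 < c) (hz : 0 < z) (u : Fin 3 → ℝ) (i : Fin 3) :
    ∫ p : Fin 3 → ℝ, p i * Real.exp (-(z / c ^ 2 *
        (√(c ^ 2 + norm3 p ^ 2) * √(c ^ 2 + norm3 u ^ 2) - dot3 p u))) =
      4 * Real.pi * c ^ 2 / z * √(c ^ 2 + norm3 u ^ 2) * u i * Kb 3 z := by
  have hnorm : ∀ v : EuclideanSpace ℝ (Fin 3), norm3 v = ‖v‖ := fun v ↦ by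
    simp [norm3, EuclideanSpace.norm_eq, Fin.sum_univ_three]
  obtain ⟨b, hb⟩ := exists_orthonormalBasis_smul_eq (WithLp.toLp 2 u)
  rw [← hnorm] at hb
  let e : (Fin 3 → ℝ) ≃ᵐ (Fin 3 → ℝ) := (MeasurableEquiv.toLp 2 (Fin 3 → ℝ)).trans
    (b.measurableEquiv.symm.trans (MeasurableEquiv.toLp 2 (Fin 3 → ℝ)).symm)
  have he : MeasurePreserving e volume volume :=
    (PiLp.volume_preserving_toLp (Fin 3)).trans
      (b.measurePreserving_measurableEquiv.symm.trans (PiLp.volume_preserving_ofLp (Fin 3)))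
  have hval : ∀ q, e q = (b.repr.symm (WithLp.toLp 2 q)).ofLp := fun q ↦ rfl
  have hcoord : ∀ q k, e q k = ∑ j, q j * b j k := fun q k ↦ by
    rw [hval, ← b.sum_repr_symm]
    simp
  have hn : ∀ q, norm3 (e q) = norm3 q := fun q ↦ by
    rw [hval, hnorm, LinearIsometryEquiv.norm_map, ← hnorm]
  have hdot : ∀ q, dot3 (e q) u = q 0 * norm3 u := fun q ↦ by
    have h1 : dot3 (e q) u = inner ℝ (WithLp.toLp 2 u) (b.repr.symm (WithLp.toLp 2 q)) := by
      simp [hval, dot3, PiLp.inner_apply, Fin.sum_univ_three]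
    rw [h1, hb, inner_smul_left, ← b.repr_apply_apply]
    simp [mul_comm]
  rw [← he.integral_comp']
  have hsum : ∀ q, e q i * Real.exp (-(z / c ^ 2 *
      (√(c ^ 2 + norm3 (e q) ^ 2) * √(c ^ 2 + norm3 u ^ 2) - dot3 (e q) u))) =
      ∑ j, b j i * (q j * axisWeight (z / c ^ 2) c (norm3 u) q) := fun q ↦ by
    rw [hn, hdot, hcoord, Finset.sum_mul]
    exact Finset.sum_congr rfl fun j _ ↦ by rw [axisWeight]; ring
  simp_rw [hsum]
  rw [integral_finsetSum _ fun j _ ↦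
    (integrable_apply_mul_axisWeight (by positivity) hc _ j).const_mul _]
  simp_rw [integral_const_mul]
  rw [Finset.sum_eq_single 0 (fun j _ hj ↦ by
    rw [integral_apply_mul_axisWeight_of_ne_zero _ _ _ hj, mul_zero]) (by simp),
    integral_apply_zero_mul_axisWeight hc hz]
  have hui : u i = norm3 u * b 0 i := by
    simpa using congrArg (fun v : EuclideanSpace ℝ (Fin 3) ↦ v i) hb
  rw [hui]
  ring

/-- The momentum moments of the Jüttner distribution:
∫ pᵢ J dp = (u₀uᵢ/c)(K₃(z)/K₂(z)) with z = c²/T. -/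
theorem juttner_momentum_moment (c T : ℝ) (hc : 0 < c) (hT : 0 < T) (u : Fin 3 → ℝ) :
    ∀ i : Fin 3,
      (∫ p : Fin 3 → ℝ, p i * Jutt c T u p) =
        (Real.sqrt (c ^ 2 + norm3 u ^ 2) * u i / c) *
          (Kb 3 (c ^ 2 / T) / Kb 2 (c ^ 2 / T)) := by
  intro i
  have hz : 0 < c ^ 2 / T := by positivity
  have hJ : ∀ p : Fin 3 → ℝ, p i * Jutt c T u p =
      (c ^ 2 / T) / (4 * Real.pi * c ^ 3 * Kb 2 (c ^ 2 / T)) *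
        (p i * Real.exp (-(c ^ 2 / T / c ^ 2 *
          (√(c ^ 2 + norm3 p ^ 2) * √(c ^ 2 + norm3 u ^ 2) - dot3 p u)))) := fun p ↦ by
    rw [Jutt, mul_left_comm]
    congr 3
    ring
  simp_rw [hJ]
  rw [integral_const_mul, integral_apply_mul_weight hc hz]
  generalize c ^ 2 / T = z at *
  by_cases hK : Kb 2 z = 0
  · simp [hK]
  have := Real.pi_pos
  field_simp
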